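/- Let d ≥ 1, r > 0, X ⊆ ℝ^d Borel, η : X → [0,1] measurable, and μ a finite Borel measure on ℝ^d with μ(ℝ^d ∖ X) = 0 that has margin-noise exponent β > 0 with constant c_MNE > 0. Let J be a finite index set, (A_j)_{j∈J} pairwise disjoint Borel sets, z_j ∈ ℝ^d with A_j ⊆ B_r(z_j), A_j ∩ X₁ ≠ ∅ and A_j ∩ X₋₁ ≠ ∅, and λ^d(B_{3r}(z_j) ∖ (X₁ ∪ X₋₁)) = 0 for every j ∈ J. Let γ_j > 0 for j ∈ J and set γ_max := max_{j∈J} γ_j. Define f_j := (π·γ_j²)^{−d/4}·(1_{B_{3r}(z_j) ∩ X₁} − 1_{B_{3r}(z_j) ∩ X₋₁}) and f*(x) := 1 if η(x) ≥ 1/2, f*(x) := −1 if η(x) < 1/2. Then Σ_{j∈J} ∫_{A_j} |(K_{γ_j} ∗ f_j)(x) − f*(x)|·|2η(x) − 1| dμ(x) ≤ (2^{1−β/2}·c_MNE^β·Γ((d+β)/2)/Γ(d/2)) · γ_max^β. -/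

import Mathlib

open Set Metric MeasureTheory ENNReal

open Classical in
/-- The distance to the decision boundary `Δ_η` associated to a posterior probability
`η` on `X`. -/
noncomputable def deltaEta {E : Type*} [PseudoEMetricSpace E]
    (X : Set E) (η : E → ℝ) (x : E) : ℝ≥0∞ :=
  if x ∈ X ∧ 1/2 < η x then EMetric.infEdist x {y ∈ X | η y < 1/2}
  else if x ∈ X ∧ η x < 1/2 then EMetric.infEdist x {y ∈ X | 1/2 < η y}
  else 0

/-- The function `K_γ(u) = (2/(√π γ))^{d/2} exp(-2‖u‖²/γ²)`. -/
noncomputable def gaussK (d : ℕ) (γ : ℝ) (u : EuclideanSpace ℝ (Fin d)) : ℝ :=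
  (2 / (Real.sqrt Real.pi * γ)) ^ ((d : ℝ) / 2) * Real.exp (-2 * ‖u‖ ^ 2 / γ ^ 2)

/-- The convolution `(K_γ ∗ g)(x) = ∫ K_γ(x - y) g(y) dλ^d(y)`. -/
noncomputable def convK (d : ℕ) (γ : ℝ) (g : EuclideanSpace ℝ (Fin d) → ℝ)
    (x : EuclideanSpace ℝ (Fin d)) : ℝ :=
  ∫ y, gaussK d γ (x - y) * g y

/-- The function `f = (π γ²)^{-d/4} (1_{B_ρ(z) ∩ X₁} - 1_{B_ρ(z) ∩ X₋₁})`. -/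
noncomputable def signFun (d : ℕ) (γ ρ : ℝ) (z : EuclideanSpace ℝ (Fin d))
    (X1 Xm1 : Set (EuclideanSpace ℝ (Fin d))) (y : EuclideanSpace ℝ (Fin d)) : ℝ :=
  (Real.pi * γ ^ 2) ^ (-(d : ℝ) / 4) *
    ((closedBall z ρ ∩ X1).indicator (fun _ => (1 : ℝ)) y
      - (closedBall z ρ ∩ Xm1).indicator (fun _ => (1 : ℝ)) y)

/-- The density `(2/π)^{d/2} exp(-2‖u‖²)` of the centred normal law with covariance `Id/4`. -/
noncomputable def gaussDensity (d : ℕ) (u : EuclideanSpace ℝ (Fin d)) : ℝ :=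
  (2 / Real.pi) ^ ((d : ℝ) / 2) * Real.exp (-2 * ‖u‖ ^ 2)

lemma gaussDensity_nonneg (d : ℕ) (u : EuclideanSpace ℝ (Fin d)) : 0 ≤ gaussDensity d u := by
  unfold gaussDensity; positivity

lemma integral_gaussDensity (d : ℕ) : ∫ u, gaussDensity d u = 1 := by
  unfold gaussDensity
  rw [integral_const_mul, GaussianFourier.integral_rexp_neg_mul_sq_norm two_pos,
    finrank_euclideanSpace_fin, ← Real.mul_rpow (by positivity) (by positivity)]
  have : 2 / Real.pi * (Real.pi / 2) = 1 := by field_simp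
  rw [this, Real.one_rpow]

lemma integrable_gaussDensity (d : ℕ) : Integrable (gaussDensity d) := by
  by_contra h
  have := integral_gaussDensity d
  rw [integral_undef h] at this
  exact zero_ne_one this

lemma integral_norm_rpow_mul_exp (d : ℕ) (hd : 1 ≤ d) {β : ℝ} (hβ : 0 ≤ β) :
    ∫ u : EuclideanSpace ℝ (Fin d), ‖u‖ ^ β * Real.exp (-2 * ‖u‖ ^ 2)
      = d * volume.real (ball (0 : EuclideanSpace ℝ (Fin d)) 1) *
        ((2 : ℝ) ^ (-((d : ℝ) + β) / 2) * (1 / 2) * Real.Gamma (((d : ℝ) + β) / 2)) := by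
  have : Nontrivial (EuclideanSpace ℝ (Fin d)) :=
    Module.nontrivial_of_finrank_pos (R := ℝ) (by rw [finrank_euclideanSpace_fin]; omega)
  rw [integral_fun_norm_addHaar volume (fun t => t ^ β * Real.exp (-2 * t ^ 2)),
    finrank_euclideanSpace_fin]
  have hd' : (1 : ℝ) ≤ d := by exact_mod_cast hd
  have key := integral_rpow_mul_exp_neg_mul_rpow (p := 2) (q := d - 1 + β) (b := 2)
    two_pos (by linarith) two_pos
  have hint : ∫ y in Ioi (0 : ℝ), y ^ (d - 1) • (y ^ β * Real.exp (-2 * y ^ 2))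
      = ∫ y in Ioi (0 : ℝ), y ^ ((d : ℝ) - 1 + β) * Real.exp (-2 * y ^ (2 : ℝ)) := by
    refine setIntegral_congr_fun measurableSet_Ioi fun y hy => ?_
    have hy : 0 < y := hy
    simp only [smul_eq_mul]
    rw [Real.rpow_add hy, Real.rpow_two, mul_assoc]
    congr 1
    rw [← Real.rpow_natCast, Nat.cast_sub hd, Nat.cast_one]
  rw [hint, key, nsmul_eq_mul, smul_eq_mul, ← mul_assoc]
  ring_nf

lemma integral_gaussDensity_mul_norm_rpow (d : ℕ) (hd : 1 ≤ d) {β : ℝ} (hβ : 0 ≤ β) :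
    ∫ u, gaussDensity d u * ‖u‖ ^ β
      = (2 : ℝ) ^ (-β / 2) * Real.Gamma (((d : ℝ) + β) / 2) / Real.Gamma ((d : ℝ) / 2) := by
  have hd' : (0 : ℝ) < d := by exact_mod_cast hd
  have hΓ : 0 < Real.Gamma ((d : ℝ) / 2) := Real.Gamma_pos_of_pos (by positivity)
  have h1 := integral_gaussDensity d
  have h0 := integral_norm_rpow_mul_exp d hd le_rfl
  have hb := integral_norm_rpow_mul_exp d hd hβ
  unfold gaussDensity at *
  simp only [Real.rpow_zero, one_mul, add_zero] at h0
  rw [integral_const_mul, h0] at h1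
  have : ∀ u : EuclideanSpace ℝ (Fin d),
      (2 / Real.pi) ^ ((d : ℝ) / 2) * Real.exp (-2 * ‖u‖ ^ 2) * ‖u‖ ^ β
        = (2 / Real.pi) ^ ((d : ℝ) / 2) * (‖u‖ ^ β * Real.exp (-2 * ‖u‖ ^ 2)) := fun u => by ring
  simp_rw [this]
  have h2 : (2 : ℝ) ^ (-((d : ℝ) + β) / 2) = 2 ^ (-(d : ℝ) / 2) * 2 ^ (-β / 2) := by
    rw [← Real.rpow_add two_pos]; ring_nf
  rw [integral_const_mul, hb, h2, eq_div_iff hΓ.ne']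
  linear_combination (2 : ℝ) ^ (-β / 2) * Real.Gamma (((d : ℝ) + β) / 2) * h1

lemma integrable_gaussDensity_mul_norm_rpow (d : ℕ) (hd : 1 ≤ d) {β : ℝ} (hβ : 0 ≤ β) :
    Integrable fun u => gaussDensity d u * ‖u‖ ^ β := by
  by_contra h
  have hd' : (0 : ℝ) < d := by exact_mod_cast hd
  have := integral_gaussDensity_mul_norm_rpow d hd hβ
  rw [integral_undef h] at this
  have h1 : 0 < Real.Gamma ((d : ℝ) / 2) := Real.Gamma_pos_of_pos (by positivity)
  have h2 : 0 < Real.Gamma (((d : ℝ) + β) / 2) := Real.Gamma_pos_of_pos (by positivity)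
  exact (by positivity : (0 : ℝ) < _).ne this

lemma gaussK_mul_const (d : ℕ) {γ : ℝ} (hγ : 0 < γ) (u : EuclideanSpace ℝ (Fin d)) :
    gaussK d γ u * (Real.pi * γ ^ 2) ^ (-(d : ℝ) / 4)
      = (γ ^ d)⁻¹ * gaussDensity d (γ⁻¹ • u) := by
  have hπ := Real.pi_pos
  have hexp : -2 * ‖γ⁻¹ • u‖ ^ 2 = -2 * ‖u‖ ^ 2 / γ ^ 2 := by
    rw [norm_smul, Real.norm_of_nonneg (by positivity)]
    field_simp
  have hc : (Real.pi * γ ^ 2) ^ (-(d : ℝ) / 4)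
      = ((Real.sqrt Real.pi * γ)⁻¹) ^ ((d : ℝ) / 2) := by
    have : Real.pi * γ ^ 2 = (Real.sqrt Real.pi * γ) ^ (2 : ℝ) := by
      rw [Real.rpow_two, mul_pow, Real.sq_sqrt hπ.le]
    rw [this, ← Real.rpow_mul (by positivity), Real.inv_rpow (by positivity),
      ← Real.rpow_neg (by positivity)]
    ring_nf
  have hg : (γ ^ d)⁻¹ = ((γ ^ 2)⁻¹) ^ ((d : ℝ) / 2) := by
    rw [Real.inv_rpow (by positivity), ← Real.rpow_two, ← Real.rpow_mul hγ.le,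
      ← Real.rpow_natCast]
    ring_nf
  unfold gaussK gaussDensity
  rw [hexp, hc, hg, mul_right_comm, ← mul_assoc, ← Real.mul_rpow (by positivity) (by positivity),
    ← Real.mul_rpow (by positivity) (by positivity)]
  congr 2
  have hs := Real.mul_self_sqrt hπ.le
  field_simp
  rw [Real.sq_sqrt hπ.le]

lemma integral_comp_inv_smul_sub (d : ℕ) {γ : ℝ} (hγ : 0 < γ)
    (F : EuclideanSpace ℝ (Fin d) → ℝ) (x : EuclideanSpace ℝ (Fin d)) :
    ∫ y, (γ ^ d)⁻¹ * F (γ⁻¹ • (x - y)) = ∫ u, F u := by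
  rw [integral_const_mul, integral_sub_left_eq_self (fun y => F (γ⁻¹ • y)),
    Measure.integral_comp_inv_smul, finrank_euclideanSpace_fin, abs_of_pos (by positivity),
    smul_eq_mul, inv_mul_cancel_left₀ (by positivity)]

lemma integrable_comp_inv_smul_sub (d : ℕ) {γ : ℝ} (hγ : 0 < γ)
    {F : EuclideanSpace ℝ (Fin d) → ℝ} (hF : Integrable F) (x : EuclideanSpace ℝ (Fin d)) :
    Integrable fun y => (γ ^ d)⁻¹ * F (γ⁻¹ • (x - y)) :=
  ((hF.comp_smul (inv_ne_zero hγ.ne')).comp_sub_left x).const_mul _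

lemma measurableSet_setOf_le_ofReal_mul_norm (d : ℕ) (D : ℝ≥0∞) (M : ℝ) :
    MeasurableSet {u : EuclideanSpace ℝ (Fin d) | D ≤ ENNReal.ofReal (M * ‖u‖)} :=
  measurableSet_le measurable_const (by fun_prop)

lemma abs_convK_signFun_sub_one_le (d : ℕ) {γ ρ : ℝ} (hγ : 0 < γ)
    (z : EuclideanSpace ℝ (Fin d)) {S T : Set (EuclideanSpace ℝ (Fin d))}
    (hS : MeasurableSet S) (hT : MeasurableSet T)
    (hST : volume (closedBall z ρ \ (S ∪ T)) = 0) (x : EuclideanSpace ℝ (Fin d)) (D : ℝ≥0∞)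
    (hD : ∀ y, edist x y < D → y ∈ closedBall z ρ ∧ y ∉ T) :
    |convK d γ (signFun d γ ρ z S T) x - 1|
      ≤ 2 * ∫ u in {u | D ≤ ENNReal.ofReal (γ * ‖u‖)}, gaussDensity d u := by
  set h : EuclideanSpace ℝ (Fin d) → ℝ := fun y =>
    (closedBall z ρ ∩ S).indicator (fun _ => (1 : ℝ)) y
      - (closedBall z ρ ∩ T).indicator (fun _ => (1 : ℝ)) y with hh
  set k : EuclideanSpace ℝ (Fin d) → ℝ := fun y =>
    (γ ^ d)⁻¹ * gaussDensity d (γ⁻¹ • (x - y)) with hk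
  have hk0 : ∀ y, 0 ≤ k y := fun y =>
    mul_nonneg (by positivity) (gaussDensity_nonneg _ _)
  have hk1 : Integrable k := integrable_comp_inv_smul_sub d hγ (integrable_gaussDensity d) x
  have hkint : ∫ y, k y = 1 := by
    rw [hk, integral_comp_inv_smul_sub d hγ, integral_gaussDensity]
  have hmeas : Measurable h :=
    (measurable_const.indicator (measurableSet_closedBall.inter hS)).sub
      (measurable_const.indicator (measurableSet_closedBall.inter hT))
  have hbd : ∀ y, |h y| ≤ 1 := fun y => by
    by_cases h1 : y ∈ closedBall z ρ ∩ S <;> by_cases h2 : y ∈ closedBall z ρ ∩ T <;>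
      simp only [hh, indicator_of_mem, indicator_of_notMem, h1, h2, not_false_eq_true] <;> norm_num
  have hconv : convK d γ (signFun d γ ρ z S T) x = ∫ y, k y * h y := by
    unfold convK signFun
    refine integral_congr_ae (.of_forall fun y => ?_)
    simp only [hk, ← gaussK_mul_const d hγ]
    ring
  have hkh : Integrable fun y => k y * h y :=
    hk1.mul_bdd hmeas.aestronglyMeasurable (.of_forall hbd)
  set V : Set (EuclideanSpace ℝ (Fin d)) := {u | D ≤ ENNReal.ofReal (γ * ‖u‖)} with hV
  have hVm : MeasurableSet V := measurableSet_setOf_le_ofReal_mul_norm d D γ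
  have hedist : ∀ y, ENNReal.ofReal (γ * ‖γ⁻¹ • (x - y)‖) = edist x y := fun y => by
    rw [norm_smul, Real.norm_of_nonneg (by positivity), mul_inv_cancel_left₀ hγ.ne',
      edist_dist, dist_eq_norm]
  rw [hconv, ← hkint, ← integral_sub hkh hk1, ← integral_indicator hVm,
    ← integral_comp_inv_smul_sub d hγ (V.indicator (gaussDensity d)) x, ← integral_const_mul, ← Real.norm_eq_abs]
  refine norm_integral_le_of_norm_le
    ((integrable_comp_inv_smul_sub d hγ ((integrable_gaussDensity d).indicator hVm) x).const_mul 2)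
    ?_
  filter_upwards [measure_eq_zero_iff_ae_notMem.1 hST] with y hy
  rw [Real.norm_eq_abs, ← mul_sub_one, abs_mul, abs_of_nonneg (hk0 y)]
  by_cases hyD : edist x y < D
  · obtain ⟨hyB, hyT⟩ := hD y hyD
    have hyS : y ∈ S := by
      by_contra hyS
      exact hy ⟨hyB, by simp [hyS, hyT]⟩
    have : h y = 1 := by simp [hh, hyB, hyT, hyS]
    rw [this, sub_self, abs_zero, mul_zero]
    exact mul_nonneg zero_le_two (mul_nonneg (by positivity)
      (indicator_nonneg (fun _ _ => gaussDensity_nonneg _ _) _))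
  · have hyV : γ⁻¹ • (x - y) ∈ V := by
      rw [hV, mem_ofPred_eq, hedist]
      exact not_lt.1 hyD
    rw [indicator_of_mem hyV, mul_comm]
    refine mul_le_mul_of_nonneg_right ?_ (hk0 y)
    have := abs_le.1 (hbd y)
    rw [abs_le]
    constructor <;> linarith

lemma signFun_swap (d : ℕ) (γ ρ : ℝ) (z : EuclideanSpace ℝ (Fin d))
    (S T : Set (EuclideanSpace ℝ (Fin d))) :
    signFun d γ ρ z S T = fun y => - signFun d γ ρ z T S y := by
  funext y
  unfold signFun
  ring

lemma convK_signFun_swap (d : ℕ) (γ ρ : ℝ) (z : EuclideanSpace ℝ (Fin d))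
    (S T : Set (EuclideanSpace ℝ (Fin d))) (x : EuclideanSpace ℝ (Fin d)) :
    convK d γ (signFun d γ ρ z S T) x = - convK d γ (signFun d γ ρ z T S) x := by
  rw [signFun_swap]
  simp only [convK, mul_neg, integral_neg]

lemma measurable_deltaEta {E : Type*} [PseudoEMetricSpace E] [MeasurableSpace E]
    [OpensMeasurableSpace E] {X : Set E} (hX : MeasurableSet X) {η : E → ℝ} (hη : Measurable η) :
    Measurable (deltaEta X η) := by
  unfold deltaEta
  refine Measurable.ite (hX.inter (measurableSet_lt measurable_const hη)) measurable_infEDist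
    (Measurable.ite (hX.inter (measurableSet_lt hη measurable_const)) measurable_infEDist
      measurable_const)

lemma mem_closedBall_three_mul_of_edist_lt_infEDist {E : Type*} [PseudoMetricSpace E]
    {x y w z : E} {r : ℝ} {T : Set E} (hx : x ∈ closedBall z r) (hw : w ∈ closedBall z r)
    (hwT : w ∈ T) (hy : edist x y < infEDist x T) : y ∈ closedBall z (3 * r) ∧ y ∉ T := by
  refine ⟨?_, fun hyT => (infEDist_le_edist_of_mem hyT).not_gt hy⟩
  have h1 : dist x y < dist x w := by
    have := hy.trans_le (infEDist_le_edist_of_mem hwT)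
    rwa [edist_dist, edist_dist, ENNReal.ofReal_lt_ofReal_iff_of_nonneg dist_nonneg] at this
  rw [mem_closedBall] at *
  have h2 := dist_triangle x z w
  have h3 := dist_triangle y x z
  rw [dist_comm z w] at h2
  rw [dist_comm y x] at h3
  linarith

/-- A bound over strict sublevel sets passes to non-strict ones, by letting the level decrease. -/
lemma setIntegral_le_of_forall_lt {E : Type*} [MeasurableSpace E] {μ : Measure E} {X : Set E}
    {δ : E → ℝ≥0∞} {W : E → ℝ} (hW0 : ∀ x, 0 ≤ W x) (hW : Integrable W μ) {β c : ℝ} (hβ : 0 < β)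
    (h : ∀ t : ℝ, 0 < t → (∫ x in {x ∈ X | δ x < ENNReal.ofReal t}, W x ∂μ) ≤ (c * t) ^ β)
    {t : ℝ} (ht : 0 ≤ t) :
    ∫ x in {x ∈ X | δ x ≤ ENNReal.ofReal t}, W x ∂μ ≤ (c * t) ^ β := by
  have hlim : Filter.Tendsto (fun s : ℝ => (c * s) ^ β) (nhdsWithin t (Ioi t))
      (nhds ((c * t) ^ β)) := by
    have : Continuous fun s : ℝ => (c * s) ^ β :=
      (continuous_const.mul continuous_id).rpow_const fun _ => Or.inr hβ.le
    exact this.continuousAt.tendsto.mono_left nhdsWithin_le_nhds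
  refine ge_of_tendsto hlim ?_
  filter_upwards [self_mem_nhdsWithin] with s hs
  have hs : t < s := hs
  refine le_trans ?_ (h s (ht.trans_lt hs))
  refine setIntegral_mono_set hW.integrableOn (.of_forall hW0)
    (LE.le.eventuallyLE fun x hx => ⟨hx.1, hx.2.trans_lt ?_⟩)
  exact (ENNReal.ofReal_lt_ofReal_iff (ht.trans_lt hs)).2 hs

lemma abs_convK_signFun_sub_sign_le (d : ℕ) {r γ : ℝ} (hγ : 0 < γ)
    {X : Set (EuclideanSpace ℝ (Fin d))} (hX : MeasurableSet X)
    {η : EuclideanSpace ℝ (Fin d) → ℝ} (hη : Measurable η) {z : EuclideanSpace ℝ (Fin d)}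
    {A : Set (EuclideanSpace ℝ (Fin d))} (hAz : A ⊆ closedBall z r)
    (hA1 : (A ∩ {x ∈ X | 1/2 < η x}).Nonempty) (hAm1 : (A ∩ {x ∈ X | η x < 1/2}).Nonempty)
    (hfull : volume (closedBall z (3 * r)
        \ ({x ∈ X | 1/2 < η x} ∪ {x ∈ X | η x < 1/2})) = 0)
    {x : EuclideanSpace ℝ (Fin d)} (hxA : x ∈ A) (hxX : x ∈ X) (hx : η x ≠ 1/2) :
    |convK d γ (signFun d γ (3 * r) z {x ∈ X | 1/2 < η x} {x ∈ X | η x < 1/2}) x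
        - (if 1/2 ≤ η x then (1 : ℝ) else -1)|
      ≤ 2 * ∫ u in {u | deltaEta X η x ≤ ENNReal.ofReal (γ * ‖u‖)}, gaussDensity d u := by
  have hm1 : MeasurableSet {x ∈ X | 1/2 < η x} := hX.inter (measurableSet_lt measurable_const hη)
  have hm2 : MeasurableSet {x ∈ X | η x < 1/2} := hX.inter (measurableSet_lt hη measurable_const)
  rcases hx.lt_or_gt with hlt | hgt
  · have hΔ : deltaEta X η x = infEDist x {y ∈ X | 1/2 < η y} := by
      rw [deltaEta, if_neg fun h => h.2.not_gt hlt, if_pos ⟨hxX, hlt⟩]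
      rfl
    obtain ⟨w, hwA, hw⟩ := hA1
    rw [if_neg (not_le.2 hlt), convK_signFun_swap, ← neg_add', abs_neg, ← sub_eq_add_neg, hΔ]
    exact abs_convK_signFun_sub_one_le d hγ z hm2 hm1 (by rwa [union_comm]) x _ fun y hy =>
      mem_closedBall_three_mul_of_edist_lt_infEDist (hAz hxA) (hAz hwA) hw hy
  · have hΔ : deltaEta X η x = infEDist x {y ∈ X | η y < 1/2} := by
      rw [deltaEta, if_pos ⟨hxX, hgt⟩]
      rfl
    obtain ⟨w, hwA, hw⟩ := hAm1
    rw [if_pos hgt.le, hΔ]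
    exact abs_convK_signFun_sub_one_le d hγ z hm1 hm2 hfull x _ fun y hy =>
      mem_closedBall_three_mul_of_edist_lt_infEDist (hAz hxA) (hAz hwA) hw hy

theorem statement9
    (d : ℕ) (hd : 1 ≤ d) (r : ℝ) (hr : 0 < r)
    (X : Set (EuclideanSpace ℝ (Fin d))) (hX : MeasurableSet X)
    (η : EuclideanSpace ℝ (Fin d) → ℝ) (hηm : Measurable η)
    (hη01 : ∀ x ∈ X, η x ∈ Icc (0 : ℝ) 1)
    (μ : Measure (EuclideanSpace ℝ (Fin d))) [IsFiniteMeasure μ] (hμX : μ Xᶜ = 0)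
    (β cMNE : ℝ) (hβ : 0 < β) (hcMNE : 0 < cMNE)
    (hMNE : ∀ t : ℝ, 0 < t →
      (∫ x in {x ∈ X | deltaEta X η x < ENNReal.ofReal t}, |2 * η x - 1| ∂μ)
        ≤ (cMNE * t) ^ β)
    (ι : Type) (J : Finset ι) (hJne : J.Nonempty)
    (A : ι → Set (EuclideanSpace ℝ (Fin d))) (hAmeas : ∀ j ∈ J, MeasurableSet (A j))
    (hdisj : (J : Set ι).PairwiseDisjoint A)
    (z : ι → EuclideanSpace ℝ (Fin d)) (hAz : ∀ j ∈ J, A j ⊆ closedBall (z j) r)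
    (hA1 : ∀ j ∈ J, (A j ∩ {x ∈ X | 1/2 < η x}).Nonempty)
    (hAm1 : ∀ j ∈ J, (A j ∩ {x ∈ X | η x < 1/2}).Nonempty)
    (hfull : ∀ j ∈ J, volume (closedBall (z j) (3 * r)
        \ ({x ∈ X | 1/2 < η x} ∪ {x ∈ X | η x < 1/2})) = 0)
    (γ : ι → ℝ) (hγ : ∀ j ∈ J, 0 < γ j) :
    ∑ j ∈ J, ∫ x in A j,
        |convK d (γ j)
            (signFun d (γ j) (3 * r) (z j) {x ∈ X | 1/2 < η x} {x ∈ X | η x < 1/2}) x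
          - (if 1/2 ≤ η x then (1 : ℝ) else -1)| * |2 * η x - 1| ∂μ
      ≤ (2 : ℝ) ^ (1 - β / 2) * cMNE ^ β * Real.Gamma (((d : ℝ) + β) / 2)
          / Real.Gamma ((d : ℝ) / 2) * (J.sup' hJne γ) ^ β := by
  set M := J.sup' hJne γ with hM
  have hγM : ∀ j ∈ J, γ j ≤ M := fun j hj => Finset.le_sup' γ hj
  have hM0 : 0 < M := by
    obtain ⟨j, hj⟩ := hJne
    exact (hγ j hj).trans_le (hγM j hj)
  set W : EuclideanSpace ℝ (Fin d) → ℝ := fun x => |2 * η x - 1| with hWdef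
  have hW0 : ∀ x, 0 ≤ W x := fun x => abs_nonneg _
  have haeX : ∀ᵐ x ∂μ, x ∈ X := by
    filter_upwards [measure_eq_zero_iff_ae_notMem.1 hμX] with x hx using not_notMem.1 hx
  have hWint : Integrable W μ := by
    refine Integrable.of_bound (C := 1) (by fun_prop) ?_
    filter_upwards [haeX] with x hx
    have := hη01 x hx
    rw [Real.norm_eq_abs, abs_of_nonneg (hW0 x), hWdef, abs_le]
    constructor <;> linarith [this.1, this.2]
  set δ := deltaEta X η with hδ
  have hδm : Measurable δ := measurable_deltaEta hX hηm
  set S : Set (EuclideanSpace ℝ (Fin d) × EuclideanSpace ℝ (Fin d)) :=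
    {p | p.1 ∈ X ∧ δ p.1 ≤ ENNReal.ofReal (M * ‖p.2‖)} with hS
  have hSm : MeasurableSet S :=
    (measurable_fst hX).inter (measurableSet_le (hδm.comp measurable_fst)
      (measurable_snd.norm.const_mul M).ennreal_ofReal)
  set k : EuclideanSpace ℝ (Fin d) → EuclideanSpace ℝ (Fin d) → ℝ := fun x u =>
    S.indicator (fun p => W p.1 * gaussDensity d p.2) (x, u) with hk
  have hk0 : ∀ x u, 0 ≤ k x u := fun x u =>
    indicator_nonneg (fun p _ => mul_nonneg (hW0 p.1) (gaussDensity_nonneg d p.2)) _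
  have hkint : Integrable (Function.uncurry k) (μ.prod volume) :=
    (hWint.mul_prod (integrable_gaussDensity d)).indicator hSm
  set H : EuclideanSpace ℝ (Fin d) → ℝ := fun x => 2 * ∫ u, k x u with hH
  have hHint : Integrable H μ := hkint.integral_prod_left.const_mul 2
  have hH0 : ∀ x, 0 ≤ H x := fun x => mul_nonneg zero_le_two (integral_nonneg (hk0 x))
  have hHeq : ∀ x ∈ X, H x =
      2 * (∫ u in {u | δ x ≤ ENNReal.ofReal (M * ‖u‖)}, gaussDensity d u) * W x := by
    intro x hx
    rw [hH, mul_assoc, mul_comm _ (W x), ← integral_const_mul,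
      ← integral_indicator (measurableSet_setOf_le_ofReal_mul_norm d _ M)]
    refine congrArg (2 * ·) (integral_congr_ae (.of_forall fun u => ?_))
    simp [hk, hS, indicator, hx]
  have hstep : ∀ j ∈ J, ∫ x in A j,
        |convK d (γ j)
            (signFun d (γ j) (3 * r) (z j) {x ∈ X | 1/2 < η x} {x ∈ X | η x < 1/2}) x
          - (if 1/2 ≤ η x then (1 : ℝ) else -1)| * W x ∂μ ≤ ∫ x in A j, H x ∂μ := by
    intro j hj
    refine integral_mono_of_nonneg (.of_forall fun x => mul_nonneg (abs_nonneg _) (hW0 x))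
      hHint.integrableOn ?_
    filter_upwards [ae_restrict_mem (hAmeas j hj), ae_restrict_of_ae haeX] with x hxA hxX
    by_cases hx : η x = 1/2
    · have : W x = 0 := by rw [hWdef]; norm_num [hx]
      rw [this, mul_zero]
      exact hH0 x
    · rw [hHeq x hxX]
      refine mul_le_mul_of_nonneg_right ((abs_convK_signFun_sub_sign_le d (hγ j hj) hX hηm
        (hAz j hj) (hA1 j hj) (hAm1 j hj) (hfull j hj) hxA hxX hx).trans ?_) (hW0 x)
      refine mul_le_mul_of_nonneg_left (setIntegral_mono_set
        (integrable_gaussDensity d).integrableOn (.of_forall (gaussDensity_nonneg d))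
        (LE.le.eventuallyLE fun u (hu : δ x ≤ _) =>
          show δ x ≤ _ from hu.trans ?_)) zero_le_two
      exact ENNReal.ofReal_le_ofReal (mul_le_mul_of_nonneg_right (hγM j hj) (norm_nonneg u))
  have hinner : ∀ u, ∫ x, k x u ∂μ ≤ (cMNE * M) ^ β * (gaussDensity d u * ‖u‖ ^ β) := by
    intro u
    have hmeas : MeasurableSet {x ∈ X | δ x ≤ ENNReal.ofReal (M * ‖u‖)} :=
      hX.inter (measurableSet_le hδm measurable_const)
    have heq : ∀ x, k x u = gaussDensity d u *
        {x ∈ X | δ x ≤ ENNReal.ofReal (M * ‖u‖)}.indicator W x := by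
      intro x
      by_cases hx : x ∈ X ∧ δ x ≤ ENNReal.ofReal (M * ‖u‖) <;>
        simp [hk, hS, indicator, hx, mul_comm]
    simp_rw [heq]
    rw [integral_const_mul, integral_indicator hmeas, mul_left_comm,
      ← Real.mul_rpow (by positivity) (by positivity), mul_assoc cMNE]
    exact mul_le_mul_of_nonneg_left
      (setIntegral_le_of_forall_lt hW0 hWint hβ hMNE (by positivity)) (gaussDensity_nonneg d u)
  calc _ ≤ ∑ j ∈ J, ∫ x in A j, H x ∂μ := Finset.sum_le_sum hstep
    _ = ∫ x in ⋃ j ∈ J, A j, H x ∂μ :=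
      (integral_biUnion_finset J hAmeas hdisj fun _ _ => hHint.integrableOn).symm
    _ ≤ ∫ x, H x ∂μ := setIntegral_le_integral hHint (.of_forall hH0)
    _ = 2 * ∫ u, ∫ x, k x u ∂μ := by rw [hH, integral_const_mul, integral_integral_swap hkint]
    _ ≤ 2 * ∫ u, (cMNE * M) ^ β * (gaussDensity d u * ‖u‖ ^ β) := by
      refine mul_le_mul_of_nonneg_left (integral_mono hkint.integral_prod_right
        ((integrable_gaussDensity_mul_norm_rpow d hd hβ.le).const_mul _) hinner) zero_le_two
    _ = _ := by
      have h2 : (2 : ℝ) ^ (1 - β / 2) = 2 * 2 ^ (-β / 2) := by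
        rw [sub_eq_add_neg, Real.rpow_add two_pos, Real.rpow_one, neg_div]
      rw [integral_const_mul, integral_gaussDensity_mul_norm_rpow d hd hβ.le, h2,
        Real.mul_rpow hcMNE.le hM0.le]
      ring
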